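/- arXiv:0704.4002 — 3 statements merged into one kernel-verified Lean document; each statement's English description precedes it below -/
import Mathlib

section
/- Let R be a commutative ring whose finitistic flat dimension is finite, i.e. there exists an integer d such that every R-module of finite flat dimension has flat dimension at most d. Let C_* be a chain complex of R-modules concentrated in non-positive degrees (C_n = 0 for n > 0, differential d_n : C_n → C_{n-1} of degree −1) such that C_n is a flat R-module and H_n(C_*) is a flat R-module for every n. Then for every R-module M and every integer n, the natural map H_n(C_*) ⊗_R M → H_n(C_* ⊗_R M) is an isomorphism of R-modules. -/
open TensorProduct

/-- `HasFlatDimLE R n M` says that the `R`-module `M` has flat dimension at most `n`: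
for `n = 0` this means `M` is flat, and for `n+1` it means that `M` admits a surjection
from a flat module whose kernel has flat dimension at most `n`. -/
def HasFlatDimLE (R : Type) [CommRing R] :
    ℕ → (M : Type) → [AddCommGroup M] → [Module R M] → Prop
  | 0, M, _, _ => Module.Flat R M
  | n + 1, M, _, _ => ∃ (F : Type) (_ : AddCommGroup F) (_ : Module R F)
      (f : F →ₗ[R] M), Module.Flat R F ∧ Function.Surjective f ∧
        HasFlatDimLE R n (LinearMap.ker f)

section ChainComplexDefs

variable {R : Type} [CommRing R] {C : ℤ → Type}
  [∀ n, AddCommGroup (C n)] [∀ n, Module R (C n)]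

/-- Transport a module along an equality of indices. -/
def lcast {m n : ℤ} (h : m = n) : C m →ₗ[R] C n := by subst h; exact LinearMap.id

variable (d : ∀ n : ℤ, C n →ₗ[R] C (n - 1))

/-- The `n`-cycles of the chain complex `(C, d)`. -/
def cyclesAt (n : ℤ) : Submodule R (C n) := LinearMap.ker (d n)

/-- The `n`-boundaries of the chain complex `(C, d)`. -/
def boundariesAt (n : ℤ) : Submodule R (C n) :=
  LinearMap.range ((lcast (show n + 1 - 1 = n by ring)).comp (d (n + 1)))

/-- The `n`-th homology of the chain complex `(C, d)`: the quotient of the cycles by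
the boundaries. -/
abbrev homologyAt (n : ℤ) : Type :=
  cyclesAt d n ⧸ (boundariesAt d n).comap (cyclesAt d n).subtype

/-- `φ` is the natural comparison map `H_n(C) ⊗ M → H_n(C ⊗ M)`: it sends the class of a
cycle `z` tensored with `m` to the class of the cycle `z ⊗ m` of the tensored complex. -/
def IsHomologyTensorComparison (M : Type) [AddCommGroup M] [Module R M] (n : ℤ)
    (φ : (homologyAt d n) ⊗[R] M →ₗ[R]
      homologyAt (C := fun k => C k ⊗[R] M) (fun k => (d k).rTensor M) n) : Prop :=
  ∀ (z : cyclesAt d n) (m : M)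
    (h : (z : C n) ⊗ₜ[R] m ∈ cyclesAt (C := fun k => C k ⊗[R] M) (fun k => (d k).rTensor M) n),
    φ ((Submodule.Quotient.mk z) ⊗ₜ[R] m) = Submodule.Quotient.mk ⟨(z : C n) ⊗ₜ[R] m, h⟩

end ChainComplexDefs

section FlatDimension

variable {R : Type} [CommRing R]

/-- An extension of flat modules is flat. -/
theorem flat_middle_of_exact {A B C : Type} [AddCommGroup A] [Module R A] [AddCommGroup B]
    [Module R B] [AddCommGroup C] [Module R C] {i : A →ₗ[R] B} {g : B →ₗ[R] C}
    (hi : Function.Injective i) (hg : Function.Surjective g) (h : Function.Exact i g)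
    [Module.Flat R A] [Module.Flat R C] : Module.Flat R B := by
  rw [Module.Flat.iff_rTensor_preserves_injective_linearMap]
  intro N N' _ _ _ _ f hf
  rw [injective_iff_map_eq_zero]
  intro x hx
  have hxC : g.lTensor N x = 0 := by
    apply Module.Flat.rTensor_preserves_injective_linearMap (M := C) f hf
    rw [map_zero, ← LinearMap.comp_apply, LinearMap.rTensor_comp_lTensor,
      ← LinearMap.lTensor_comp_rTensor, LinearMap.comp_apply, hx, map_zero]
  obtain ⟨y, rfl⟩ := (lTensor_exact N h hg x).1 hxC
  have hy : y = 0 := by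
    apply Module.Flat.rTensor_preserves_injective_linearMap (M := A) f hf
    apply LinearMap.lTensor_injective_of_exact_of_flat g hg i hi h N'
    rw [map_zero, map_zero, ← LinearMap.comp_apply, LinearMap.lTensor_comp_rTensor,
      ← LinearMap.rTensor_comp_lTensor, LinearMap.comp_apply, hx]
  rw [hy, map_zero]

/-- The kernel of a surjection between flat modules is flat. -/
theorem flat_left_of_exact {A B C : Type} [AddCommGroup A] [Module R A] [AddCommGroup B]
    [Module R B] [AddCommGroup C] [Module R C] {i : A →ₗ[R] B} {g : B →ₗ[R] C}
    (hi : Function.Injective i) (hg : Function.Surjective g) (h : Function.Exact i g)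
    [Module.Flat R B] [Module.Flat R C] : Module.Flat R A := by
  rw [Module.Flat.iff_rTensor_preserves_injective_linearMap]
  intro N N' _ _ _ _ f hf
  have hinj : Function.Injective (f.rTensor B ∘ₗ i.lTensor N) :=
    (Module.Flat.rTensor_preserves_injective_linearMap (M := B) f hf).comp
      (LinearMap.lTensor_injective_of_exact_of_flat g hg i hi h N)
  rw [LinearMap.rTensor_comp_lTensor, ← LinearMap.lTensor_comp_rTensor] at hinj
  exact Function.Injective.of_comp hinj

theorem HasFlatDimLE.of_linearEquiv {n : ℕ} {M N : Type} [AddCommGroup M] [Module R M]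
    [AddCommGroup N] [Module R N] (e : M ≃ₗ[R] N) (h : HasFlatDimLE R n M) :
    HasFlatDimLE R n N := by
  cases n with
  | zero =>
    have : Module.Flat R M := h
    exact Module.Flat.of_linearEquiv e.symm
  | succ n =>
    obtain ⟨F, _, _, f, hF, hf, hk⟩ := h
    refine ⟨F, _, _, e.toLinearMap ∘ₗ f, hF, e.surjective.comp hf, ?_⟩
    rwa [LinearEquiv.ker_comp]

/-- The left term of a left exact sequence is isomorphic to the kernel of the second map. -/
noncomputable def kerEquivOfExact {A B C : Type} [AddCommGroup A] [Module R A] [AddCommGroup B]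
    [Module R B] [AddCommGroup C] [Module R C] {i : A →ₗ[R] B} {g : B →ₗ[R] C}
    (hi : Function.Injective i) (h : Function.Exact i g) : A ≃ₗ[R] LinearMap.ker g :=
  (LinearEquiv.ofInjective i hi).trans (LinearEquiv.ofEq _ _ h.linearMap_ker_eq.symm)

theorem HasFlatDimLE.succ_of_exact {n : ℕ} {K F M : Type} [AddCommGroup K] [Module R K]
    [AddCommGroup F] [Module R F] [AddCommGroup M] [Module R M] {i : K →ₗ[R] F} {g : F →ₗ[R] M}
    (hi : Function.Injective i) (hg : Function.Surjective g) (h : Function.Exact i g)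
    (hF : Module.Flat R F) (hK : HasFlatDimLE R n K) : HasFlatDimLE R (n + 1) M :=
  ⟨F, _, _, g, hF, hg, hK.of_linearEquiv (kerEquivOfExact hi h)⟩

/-- In every short exact sequence with flat right term, the left term has flat dimension at
most `n` if and only if the middle term has. -/
def FlatDimInvariant (R : Type) [CommRing R] (n : ℕ) : Prop :=
  ∀ ⦃A B C : Type⦄ [AddCommGroup A] [Module R A] [AddCommGroup B] [Module R B] [AddCommGroup C]
    [Module R C] (i : A →ₗ[R] B) (g : B →ₗ[R] C), Function.Injective i → Function.Surjective g →
    Function.Exact i g → Module.Flat R C → (HasFlatDimLE R n A ↔ HasFlatDimLE R n B)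

/-- Schanuel's argument: the pullback of two flat covers of `M` compares their kernels. -/
theorem FlatDimInvariant.ker {n : ℕ} (hn : FlatDimInvariant R n) {F M : Type} [AddCommGroup F]
    [Module R F] [AddCommGroup M] [Module R M] {g : F →ₗ[R] M} (hF : Module.Flat R F)
    (hg : Function.Surjective g) (hM : HasFlatDimLE R (n + 1) M) :
    HasFlatDimLE R n (LinearMap.ker g) := by
  obtain ⟨F', _, _, f, hF', hf, hk⟩ := hM
  let P : Submodule R (F × F') := LinearMap.eqLocus (g ∘ₗ LinearMap.fst R F F')
    (f ∘ₗ LinearMap.snd R F F')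
  let i₁ : LinearMap.ker f →ₗ[R] P :=
    (LinearMap.inr R F F' ∘ₗ (LinearMap.ker f).subtype).codRestrict P (by
      rintro ⟨x, hx⟩
      have hx : f x = 0 := hx
      simp [P, hx])
  let i₂ : LinearMap.ker g →ₗ[R] P :=
    (LinearMap.inl R F F' ∘ₗ (LinearMap.ker g).subtype).codRestrict P (by
      rintro ⟨x, hx⟩
      have hx : g x = 0 := hx
      simp [P, hx])
  have h₁ : HasFlatDimLE R n (LinearMap.ker f) ↔ HasFlatDimLE R n P := by
    refine hn i₁ (LinearMap.fst R F F' ∘ₗ P.subtype) ?_ ?_ ?_ hF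
    · intro x y hxy
      exact Subtype.ext (congrArg (fun p : P => p.1.2) hxy)
    · intro x
      obtain ⟨y, hy⟩ := hf (g x)
      exact ⟨⟨(x, y), hy.symm⟩, rfl⟩
    · rintro ⟨⟨x, y⟩, hxy⟩
      have hxy : g x = f y := hxy
      constructor
      · intro h
        have h : x = 0 := h
        subst h
        exact ⟨⟨y, by rw [LinearMap.mem_ker, ← hxy, map_zero]⟩, rfl⟩
      · rintro ⟨z, hz⟩
        exact (congrArg (fun p : P => p.1.1) hz).symm
  have h₂ : HasFlatDimLE R n (LinearMap.ker g) ↔ HasFlatDimLE R n P := by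
    refine hn i₂ (LinearMap.snd R F F' ∘ₗ P.subtype) ?_ ?_ ?_ hF'
    · intro x y hxy
      exact Subtype.ext (congrArg (fun p : P => p.1.1) hxy)
    · intro y
      obtain ⟨x, hx⟩ := hg (f y)
      exact ⟨⟨(x, y), hx⟩, rfl⟩
    · rintro ⟨⟨x, y⟩, hxy⟩
      have hxy : g x = f y := hxy
      constructor
      · intro h
        have h : y = 0 := h
        subst h
        exact ⟨⟨x, by rw [LinearMap.mem_ker, hxy, map_zero]⟩, rfl⟩
      · rintro ⟨z, hz⟩
        exact (congrArg (fun p : P => p.1.2) hz).symm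
  exact h₂.2 (h₁.1 hk)

theorem flatDimInvariant (n : ℕ) : FlatDimInvariant R n := by
  induction n with
  | zero =>
    intro A B C _ _ _ _ _ _ i g hi hg h hC
    constructor
    · intro hA
      have : Module.Flat R A := hA
      exact flat_middle_of_exact hi hg h
    · intro hB
      have : Module.Flat R B := hB
      exact flat_left_of_exact hi hg h
  | succ n ih =>
    intro A B C _ _ _ _ _ _ i g hi hg h hC
    -- Restrict a flat cover `π` of `B` to the preimage of `ker g`.
    have cover : ∀ {F : Type} [AddCommGroup F] [Module R F] (π : F →ₗ[R] B),
        Module.Flat R F → Function.Surjective π →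
        ∃ (G : Type) (_ : AddCommGroup G) (_ : Module R G) (j : LinearMap.ker π →ₗ[R] G)
          (p : G →ₗ[R] LinearMap.ker g), Module.Flat R G ∧ Function.Injective j ∧
          Function.Surjective p ∧ Function.Exact j p := by
      intro F _ _ π hF hπ
      refine ⟨LinearMap.ker (g ∘ₗ π), inferInstance, inferInstance,
        Submodule.inclusion (LinearMap.ker_le_ker_comp π g),
        π.restrict (fun x hx => hx), ?_, Submodule.inclusion_injective _, ?_, ?_⟩
      · exact flat_left_of_exact (Submodule.subtype_injective _) (hg.comp hπ)
          (LinearMap.exact_subtype_ker_map (g ∘ₗ π))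
      · rintro ⟨b, hb⟩
        obtain ⟨x, rfl⟩ := hπ b
        exact ⟨⟨x, hb⟩, rfl⟩
      · rintro ⟨x, hx⟩
        constructor
        · intro hx0
          exact ⟨⟨x, congrArg Subtype.val hx0⟩, rfl⟩
        · rintro ⟨⟨z, hz⟩, hzx⟩
          obtain rfl : z = x := congrArg Subtype.val hzx
          exact Subtype.ext hz
    constructor
    · intro hA
      obtain ⟨F, _, _, π, hF, hπ⟩ : ∃ (F : Type) (_ : AddCommGroup F) (_ : Module R F)
          (π : F →ₗ[R] B), Module.Flat R F ∧ Function.Surjective π :=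
        ⟨B →₀ R, _, _, Finsupp.linearCombination R id, inferInstance,
          Finsupp.linearCombination_surjective _ Function.surjective_id⟩
      obtain ⟨G, _, _, j, p, hG, hj, hp, hjp⟩ := cover π hF hπ
      exact ⟨F, _, _, π, hF, hπ, (ih.ker hG hp (HasFlatDimLE.of_linearEquiv
        (kerEquivOfExact hi h) hA)).of_linearEquiv (kerEquivOfExact hj hjp).symm⟩
    · rintro ⟨F, _, _, π, hF, hπ, hK⟩
      obtain ⟨G, _, _, j, p, hG, hj, hp, hjp⟩ := cover π hF hπ
      exact (HasFlatDimLE.succ_of_exact hj hp hjp hG hK).of_linearEquiv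
        (kerEquivOfExact hi h).symm

end FlatDimension

section ChainComplexLemmas

variable {R : Type} [CommRing R] {C : ℤ → Type}
  [∀ n, AddCommGroup (C n)] [∀ n, Module R (C n)]

theorem range_lcast_comp (d : ∀ n : ℤ, C n →ₗ[R] C (n - 1)) {m k : ℤ} (h : m - 1 = k) :
    LinearMap.range ((lcast (C := C) h).comp (d m)) = boundariesAt d k := by
  obtain rfl : m = k + 1 := by omega
  rfl

variable (d : ∀ n : ℤ, C n →ₗ[R] C (n - 1))

theorem range_eq_boundariesAt (n : ℤ) : LinearMap.range (d n) = boundariesAt d (n - 1) :=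
  range_lcast_comp d (m := n) rfl

/-- The differential as a map onto the boundaries. -/
def toBoundaries (n : ℤ) : C n →ₗ[R] boundariesAt d (n - 1) :=
  (d n).codRestrict _ fun x => range_eq_boundariesAt d n ▸ LinearMap.mem_range_self _ x

theorem toBoundaries_surjective (n : ℤ) : Function.Surjective (toBoundaries d n) := by
  rintro ⟨y, hy⟩
  rw [← range_eq_boundariesAt] at hy
  obtain ⟨x, rfl⟩ := hy
  exact ⟨x, rfl⟩

theorem exact_toBoundaries (n : ℤ) :
    Function.Exact (cyclesAt d n).subtype (toBoundaries d n) := by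
  intro x
  rw [← Subtype.val_inj]
  exact LinearMap.exact_subtype_ker_map (d n) x

theorem boundariesAt_le_cyclesAt (hd : ∀ n : ℤ, (d (n - 1)).comp (d n) = 0) (n : ℤ) :
    boundariesAt d n ≤ cyclesAt d n := by
  obtain ⟨m, rfl⟩ : ∃ m, n = m - 1 := ⟨n + 1, by omega⟩
  rw [← range_eq_boundariesAt]
  exact LinearMap.range_le_ker_iff.2 (hd m)

theorem exact_inclusion_mkQ (hd : ∀ n : ℤ, (d (n - 1)).comp (d n) = 0) (n : ℤ) :
    Function.Exact (Submodule.inclusion (boundariesAt_le_cyclesAt d hd n))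
      ((boundariesAt d n).comap (cyclesAt d n).subtype).mkQ := by
  rw [LinearMap.exact_iff, Submodule.ker_mkQ, Submodule.range_inclusion]

/-- All boundaries of a bounded above complex of flat modules with flat homology have finite
flat dimension. -/
theorem exists_hasFlatDimLE_boundariesAt (hd : ∀ n : ℤ, (d (n - 1)).comp (d n) = 0)
    (hnonpos : ∀ n : ℤ, 0 < n → Subsingleton (C n)) (hC : ∀ n : ℤ, Module.Flat R (C n))
    (hH : ∀ n : ℤ, Module.Flat R (homologyAt d n)) (n : ℤ) :
    ∃ k, HasFlatDimLE R k (boundariesAt d n) := by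
  have hpos : ∀ m : ℤ, 0 < m → ∃ k, HasFlatDimLE R k (boundariesAt d m) := by
    intro m hm
    have := hnonpos m hm
    exact ⟨0, (inferInstance : Module.Flat R (boundariesAt d m))⟩
  rcases lt_or_ge 0 n with h | h
  · exact hpos n h
  induction n, (h.trans zero_le_one : n ≤ 1) using Int.leInductionDown with
  | base => exact hpos 1 one_pos
  | pred n hn ih =>
    obtain ⟨k, hk⟩ : ∃ k, HasFlatDimLE R k (boundariesAt d n) := by
      rcases lt_or_ge 0 n with h | h
      · exact hpos n h
      · exact ih h
    exact ⟨k + 1, HasFlatDimLE.succ_of_exact (cyclesAt d n).subtype_injective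
      (toBoundaries_surjective d n) (exact_toBoundaries d n) (hC n)
      ((flatDimInvariant k _ _ (Submodule.inclusion_injective _) (Submodule.mkQ_surjective _)
        (exact_inclusion_mkQ d hd n) (hH n)).1 hk)⟩

/-- A uniform bound on the flat dimension of the boundaries can be lowered to zero. -/
theorem flat_boundariesAt (hd : ∀ n : ℤ, (d (n - 1)).comp (d n) = 0)
    (hC : ∀ n : ℤ, Module.Flat R (C n)) (hH : ∀ n : ℤ, Module.Flat R (homologyAt d n))
    {k : ℕ} (hk : ∀ n, HasFlatDimLE R k (boundariesAt d n)) (n : ℤ) :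
    Module.Flat R (boundariesAt d n) := by
  induction k with
  | zero => exact hk n
  | succ k ih =>
    refine ih fun n => ?_
    rw [flatDimInvariant k _ _ (Submodule.inclusion_injective _) (Submodule.mkQ_surjective _)
        (exact_inclusion_mkQ d hd n) (hH n)]
    exact ((flatDimInvariant k).ker (hC n) (toBoundaries_surjective d n)
      (hk (n - 1))).of_linearEquiv
      (kerEquivOfExact (cyclesAt d n).subtype_injective (exact_toBoundaries d n)).symm

variable (M : Type) [AddCommGroup M] [Module R M]

theorem rTensor_injective_of_exact_of_flat {A B D : Type} [AddCommGroup A] [Module R A]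
    [AddCommGroup B] [Module R B] [AddCommGroup D] [Module R D] [Module.Flat R D]
    {i : A →ₗ[R] B} {g : B →ₗ[R] D} (hi : Function.Injective i) (hg : Function.Surjective g)
    (h : Function.Exact i g) : Function.Injective (i.rTensor M) :=
  (i.lTensor_inj_iff_rTensor_inj M).1
    (LinearMap.lTensor_injective_of_exact_of_flat g hg i hi h M)

theorem boundariesAt_rTensor (n : ℤ) :
    boundariesAt (C := fun k => C k ⊗[R] M) (fun k => (d k).rTensor M) n =
      LinearMap.range ((boundariesAt d n).subtype.rTensor M) := by
  obtain ⟨m, rfl⟩ : ∃ m, n = m - 1 := ⟨n + 1, by omega⟩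
  rw [← range_eq_boundariesAt]
  change LinearMap.range (((boundariesAt d (m - 1)).subtype ∘ₗ toBoundaries d m).rTensor M) = _
  rw [LinearMap.rTensor_comp, LinearMap.range_comp_of_range_eq_top]
  exact LinearMap.range_eq_top.2 (LinearMap.rTensor_surjective M (toBoundaries_surjective d m))

theorem rTensor_subtype_cyclesAt_injective (hB : ∀ n, Module.Flat R (boundariesAt d n)) (n : ℤ) :
    Function.Injective ((cyclesAt d n).subtype.rTensor M) :=
  rTensor_injective_of_exact_of_flat M (cyclesAt d n).subtype_injective
    (toBoundaries_surjective d n) (exact_toBoundaries d n)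

theorem cyclesAt_rTensor (hd : ∀ n : ℤ, (d (n - 1)).comp (d n) = 0)
    (hH : ∀ n : ℤ, Module.Flat R (homologyAt d n))
    (hB : ∀ n, Module.Flat R (boundariesAt d n)) (n : ℤ) :
    cyclesAt (C := fun k => C k ⊗[R] M) (fun k => (d k).rTensor M) n =
      LinearMap.range ((cyclesAt d n).subtype.rTensor M) := by
  have hinj : Function.Injective ((boundariesAt d (n - 1)).subtype.rTensor M) := by
    have hBZ := rTensor_injective_of_exact_of_flat M
      (Submodule.inclusion_injective (boundariesAt_le_cyclesAt d hd (n - 1)))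
      (Submodule.mkQ_surjective _) (exact_inclusion_mkQ d hd (n - 1))
    have := (rTensor_subtype_cyclesAt_injective d M hB (n - 1)).comp hBZ
    rwa [← LinearMap.coe_comp, ← LinearMap.rTensor_comp] at this
  change LinearMap.ker (((boundariesAt d (n - 1)).subtype ∘ₗ toBoundaries d n).rTensor M) = _
  rw [LinearMap.rTensor_comp, LinearMap.ker_comp_of_ker_eq_bot _ (LinearMap.ker_eq_bot.2 hinj)]
  exact (rTensor_exact M (exact_toBoundaries d n) (toBoundaries_surjective d n)).linearMap_ker_eq

theorem IsHomologyTensorComparison.bijective (hd : ∀ n : ℤ, (d (n - 1)).comp (d n) = 0)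
    (hH : ∀ n : ℤ, Module.Flat R (homologyAt d n))
    (hB : ∀ n, Module.Flat R (boundariesAt d n)) (n : ℤ)
    (φ : (homologyAt d n) ⊗[R] M →ₗ[R]
      homologyAt (C := fun k => C k ⊗[R] M) (fun k => (d k).rTensor M) n)
    (hφ : IsHomologyTensorComparison d M n φ) : Function.Bijective φ := by
  have hZ := cyclesAt_rTensor d M hd hH hB n
  have hmem : ∀ w, (cyclesAt d n).subtype.rTensor M w ∈
      cyclesAt (C := fun k => C k ⊗[R] M) (fun k => (d k).rTensor M) n :=
    fun w => hZ ▸ LinearMap.mem_range_self _ w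
  let j := ((cyclesAt d n).subtype.rTensor M).codRestrict _ hmem
  let q := ((boundariesAt d n).comap (cyclesAt d n).subtype).mkQ
  have hq : Function.Surjective (q.rTensor M) :=
    LinearMap.rTensor_surjective M (Submodule.mkQ_surjective _)
  have hcomp : φ ∘ₗ q.rTensor M = Submodule.mkQ _ ∘ₗ j :=
    TensorProduct.ext' fun z m => hφ z m (hmem (z ⊗ₜ m))
  have hcomp (w) : φ (q.rTensor M w) = Submodule.mkQ _ (j w) := LinearMap.congr_fun hcomp w
  constructor
  · rw [injective_iff_map_eq_zero]
    intro x hx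
    obtain ⟨w, rfl⟩ := hq x
    rw [hcomp, Submodule.mkQ_apply, Submodule.Quotient.mk_eq_zero] at hx
    have hx : (cyclesAt d n).subtype.rTensor M w ∈
      boundariesAt (C := fun k => C k ⊗[R] M) (fun k => (d k).rTensor M) n := hx
    rw [boundariesAt_rTensor] at hx
    obtain ⟨y, hy⟩ := hx
    refine (rTensor_exact M (exact_inclusion_mkQ d hd n) (Submodule.mkQ_surjective _) w).2
      ⟨y, rTensor_subtype_cyclesAt_injective d M hB n ?_⟩
    rw [← hy, ← LinearMap.comp_apply, ← LinearMap.rTensor_comp]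
    rfl
  · intro y
    obtain ⟨⟨z, hz⟩, rfl⟩ := Submodule.mkQ_surjective _ y
    obtain ⟨w, rfl⟩ : z ∈ LinearMap.range ((cyclesAt d n).subtype.rTensor M) := hZ ▸ hz
    exact ⟨q.rTensor M w, hcomp w⟩

end ChainComplexLemmas

/-- Let `R` be a commutative ring of finite finitistic flat dimension, and let
`(C, d)` be a chain complex of `R`-modules concentrated in non-positive degrees with all
`C n` flat and all homology modules `H_n(C)` flat.  Then for every `R`-module `M` and
every `n`, the natural map `H_n(C) ⊗ M → H_n(C ⊗ M)` is an isomorphism (i.e. every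
linear map satisfying its defining property is bijective). -/
theorem steenrod_stmt_0 (R : Type) [CommRing R]
    (hfinitistic : ∃ dd : ℕ, ∀ (M : Type) [AddCommGroup M] [Module R M],
      (∃ n : ℕ, HasFlatDimLE R n M) → HasFlatDimLE R dd M)
    (C : ℤ → Type) [∀ n, AddCommGroup (C n)] [∀ n, Module R (C n)]
    (d : ∀ n : ℤ, C n →ₗ[R] C (n - 1))
    (hcomplex : ∀ n : ℤ, (d (n - 1)).comp (d n) = 0)
    (hnonpos : ∀ n : ℤ, 0 < n → Subsingleton (C n))
    (hCflat : ∀ n : ℤ, Module.Flat R (C n))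
    (hHflat : ∀ n : ℤ, Module.Flat R (homologyAt d n)) :
    ∀ (M : Type) [AddCommGroup M] [Module R M] (n : ℤ)
      (φ : (homologyAt d n) ⊗[R] M →ₗ[R]
        homologyAt (C := fun k => C k ⊗[R] M) (fun k => (d k).rTensor M) n),
      IsHomologyTensorComparison d M n φ → Function.Bijective φ := by
  obtain ⟨k, hk⟩ := hfinitistic
  intro M _ _ n φ hφ
  exact hφ.bijective d M hcomplex hHflat (flat_boundariesAt d hcomplex hCflat hHflat fun m =>
    hk _ (exists_hasFlatDimLE_boundariesAt d hcomplex hnonpos hCflat hHflat m)) n φ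
end

section
/- Let R be a commutative Noetherian ring, I an arbitrary index set, and (M_i)_{i ∈ I} a family of flat R-modules. Then the product ∏_{i ∈ I} M_i is a flat R-module. In particular, for any set S, the R-module R^S of all functions from S to R is flat. -/
/-- If `g` spans the syzygies of `f`, then every relation `∑ i, f i • x i = 0` in a flat module
is explained by `g`. -/
theorem Module.Flat.exists_eq_sum_smul_of_span_eq_ker {R M : Type*} [CommRing R] [AddCommGroup M]
    [Module R M] [Module.Flat R M] {l n : ℕ} {f : Fin l → R} {g : Fin n → Fin l → R}
    (hg : Submodule.span R (Set.range g) = LinearMap.ker (Fintype.linearCombination R f))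
    {x : Fin l → M} (hx : ∑ i, f i • x i = 0) :
    ∃ y : Fin n → M, ∀ i, x i = ∑ j, g j i • y j := by
  obtain ⟨k, a, y, hxa, ha⟩ := Module.Flat.isTrivialRelation_of_sum_smul_eq_zero hx
  have hmem (j : Fin k) : (fun i ↦ a i j) ∈ Submodule.span R (Set.range g) := by
    rw [hg, LinearMap.mem_ker, Fintype.linearCombination_apply, ← ha j]
    exact Finset.sum_congr rfl fun i _ ↦ mul_comm _ _
  choose c hc using fun j ↦ (Submodule.mem_span_range_iff_exists_fun R).mp (hmem j)
  refine ⟨fun m ↦ ∑ j, c j m • y j, fun i ↦ ?_⟩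
  have hac (j : Fin k) : a i j = ∑ m, g m i * c j m := by
    simpa [mul_comm] using (congrFun (hc j) i).symm
  simp_rw [hxa i, hac, Finset.sum_smul, Finset.smul_sum, smul_smul]
  exact Finset.sum_comm

/-- Over a Noetherian ring, a product of flat modules is flat. -/
theorem Module.Flat.pi_of_isNoetherianRing {R I : Type*} [CommRing R] [IsNoetherianRing R]
    (M : I → Type*) [∀ i, AddCommGroup (M i)] [∀ i, Module R (M i)]
    [∀ i, Module.Flat R (M i)] : Module.Flat R (∀ i, M i) := by
  refine Module.Flat.of_forall_isTrivialRelation fun {l f x} hx ↦ ?_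
  obtain ⟨n, g, hg⟩ := Submodule.fg_iff_exists_fin_generating_family.mp
    (IsNoetherian.noetherian (LinearMap.ker (Fintype.linearCombination R f)))
  have hx' (s : I) : ∑ i, f i • x i s = 0 := by simpa using congrFun hx s
  choose y hy using fun s ↦ Module.Flat.exists_eq_sum_smul_of_span_eq_ker hg (hx' s)
  refine ⟨n, fun i j ↦ g j i, fun j s ↦ y s j, fun i ↦ ?_, fun j ↦ ?_⟩
  · ext s
    simpa using hy s i
  · have hj : g j ∈ LinearMap.ker (Fintype.linearCombination R f) :=
      hg ▸ Submodule.subset_span (Set.mem_range_self j)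
    simpa [Fintype.linearCombination_apply, mul_comm] using hj


/-- Over a commutative Noetherian ring `R`, an arbitrary product of flat
`R`-modules is flat; in particular, for any set `S` the module `R^S` of all functions
`S → R` is flat. -/
theorem steenrod_stmt_8 (R : Type) [CommRing R] [IsNoetherianRing R]
    (I : Type) (M : I → Type) [∀ i, AddCommGroup (M i)] [∀ i, Module R (M i)]
    (hM : ∀ i, Module.Flat R (M i)) :
    Module.Flat R (∀ i, M i) ∧ ∀ S : Type, Module.Flat R (S → R) := by
  exact ⟨Module.Flat.pi_of_isNoetherianRing M,
    fun S ↦ Module.Flat.pi_of_isNoetherianRing fun _ : S ↦ R⟩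
end

section
/- Let R be a commutative Noetherian ring of finite Krull dimension d. Then every R-module of finite flat dimension has flat dimension at most d; that is, the finitistic flat dimension of R is at most its Krull dimension. -/
open Function TensorProduct in
theorem LinearMap.lTensor_injective_of_exact {R : Type*} [CommRing R]
    {K F N₁ N₂ N₃ : Type*} [AddCommGroup K] [Module R K] [AddCommGroup F] [Module R F]
    [Module.Flat R F] [AddCommGroup N₁] [Module R N₁] [AddCommGroup N₂] [Module R N₂]
    [AddCommGroup N₃] [Module R N₃] {f : K →ₗ[R] F} {i : N₁ →ₗ[R] N₂} {q : N₂ →ₗ[R] N₃}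
    (hi : Injective i) (hq : Surjective q) (hiq : Exact i q)
    (h₁ : Injective (f.lTensor N₁)) (h₃ : Injective (f.lTensor N₃)) :
    Injective (f.lTensor N₂) := by
  rw [injective_iff_map_eq_zero]
  intro u hu
  have huq : q.rTensor K u = 0 := by
    apply (injective_iff_map_eq_zero _).mp h₃
    rw [← LinearMap.comp_apply, LinearMap.lTensor_comp_rTensor, ← LinearMap.rTensor_comp_lTensor,
      LinearMap.comp_apply, hu, map_zero]
  obtain ⟨v, rfl⟩ := (rTensor_exact K hiq hq u).mp huq
  suffices v = 0 by rw [this, map_zero]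
  apply (injective_iff_map_eq_zero _).mp h₁
  apply (injective_iff_map_eq_zero _).mp
    (Module.Flat.rTensor_preserves_injective_linearMap (M := F) i hi)
  rw [← LinearMap.comp_apply, LinearMap.rTensor_comp_lTensor, ← LinearMap.lTensor_comp_rTensor,
    LinearMap.comp_apply, hu]

open Function TensorProduct in
theorem LinearMap.lTensor_injective_of_injective {R : Type*} [CommRing R]
    {K F N₁ N₂ : Type*} [AddCommGroup K] [Module R K] [AddCommGroup F] [Module R F]
    [Module.Flat R K] [AddCommGroup N₁] [Module R N₁] [AddCommGroup N₂] [Module R N₂]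
    {f : K →ₗ[R] F} {i : N₁ →ₗ[R] N₂}
    (hi : Injective i) (h₂ : Injective (f.lTensor N₂)) :
    Injective (f.lTensor N₁) := by
  have h := h₂.comp (Module.Flat.rTensor_preserves_injective_linearMap (M := K) i hi)
  rw [← LinearMap.coe_comp, LinearMap.lTensor_comp_rTensor, ← LinearMap.rTensor_comp_lTensor,
    LinearMap.coe_comp] at h
  exact h.of_comp

open Function TensorProduct in
/-- A module `M` is flat if `Tor₁(R ⧸ I, M)` vanishes for all ideals `I`, where `Tor₁` is computed
from a presentation of `M` by a flat module. -/
theorem Module.flat_of_forall_lTensor_injective {R : Type*} [CommRing R]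
    {K F M : Type*} [AddCommGroup K] [Module R K] [AddCommGroup F] [Module R F]
    [AddCommGroup M] [Module R M] [Module.Flat R F] {f : K →ₗ[R] F} {g : F →ₗ[R] M}
    (hg : Surjective g) (hfg : Exact f g)
    (h : ∀ I : Ideal R, Function.Injective (f.lTensor (R ⧸ I))) : Module.Flat R M := by
  rw [Module.Flat.iff_rTensor_injective']
  intro I
  rw [injective_iff_map_eq_zero]
  intro z hz
  obtain ⟨z, rfl⟩ := LinearMap.lTensor_surjective I hg z
  have hz' : g.lTensor R (I.subtype.rTensor F z) = 0 := by
    rw [← LinearMap.comp_apply, LinearMap.lTensor_comp_rTensor, ← LinearMap.rTensor_comp_lTensor,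
      LinearMap.comp_apply, hz]
  obtain ⟨w, hw⟩ := (lTensor_exact R hfg hg _).mp hz'
  have hIQ : Exact I.subtype I.mkQ := LinearMap.exact_subtype_mkQ I
  have hwQ : I.mkQ.rTensor K w = 0 := by
    apply (injective_iff_map_eq_zero _).mp (h I)
    rw [← LinearMap.comp_apply, LinearMap.lTensor_comp_rTensor, ← LinearMap.rTensor_comp_lTensor,
      LinearMap.comp_apply, hw]
    exact (rTensor_exact F hIQ I.mkQ_surjective).apply_apply_eq_zero z
  obtain ⟨w, rfl⟩ := (rTensor_exact K hIQ I.mkQ_surjective w).mp hwQ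
  suffices f.lTensor I w = z by
    rw [← this]
    exact (lTensor_exact I hfg hg).apply_apply_eq_zero w
  apply Module.Flat.rTensor_preserves_injective_linearMap (M := F) I.subtype I.subtype_injective
  rw [← hw, ← LinearMap.comp_apply, LinearMap.rTensor_comp_lTensor,
    ← LinearMap.lTensor_comp_rTensor, LinearMap.comp_apply]

universe u

/-- `IsSyzygy R n K` says that the `R`-module `K` is an `n`-th syzygy with respect to flat
modules: there is an exact sequence `0 → K → Fₙ₋₁ → ⋯ → F₀` with all `Fᵢ` flat. -/
def IsSyzygy (R : Type u) [CommRing R] :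
    ℕ → (K : Type u) → [AddCommGroup K] → [Module R K] → Prop
  | 0, _, _, _ => True
  | n + 1, K, _, _ => ∃ (F : Type u) (_ : AddCommGroup F) (_ : Module R F)
      (M : Type u) (_ : AddCommGroup M) (_ : Module R M) (f : K →ₗ[R] F) (g : F →ₗ[R] M),
        Module.Flat R F ∧ Function.Injective f ∧ Function.Exact f g ∧ Function.Surjective g ∧
          IsSyzygy R n M

theorem IsSyzygy.of_succ {R : Type u} [CommRing R] {n : ℕ} {K : Type u} [AddCommGroup K]
    [Module R K] (h : IsSyzygy R (n + 1) K) : IsSyzygy R n K := by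
  induction n generalizing K with
  | zero => trivial
  | succ n ih =>
    obtain ⟨F, _, _, M, _, _, f, g, hF, hf, hfg, hg, hM⟩ := h
    exact ⟨F, _, _, M, _, _, f, g, hF, hf, hfg, hg, ih hM⟩

/-- `TorVanishes R n N` says that `Tor₁(N, K) = 0` for every `n`-th syzygy `K`,
that is, `Torₙ₊₁(N, -) = 0`. -/
def TorVanishes (R : Type u) [CommRing R] (n : ℕ) (N : Type u) [AddCommGroup N] [Module R N] :
    Prop :=
  ∀ (K F M : Type u) [AddCommGroup K] [Module R K] [AddCommGroup F] [Module R F]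
    [AddCommGroup M] [Module R M] (f : K →ₗ[R] F) (g : F →ₗ[R] M),
    Module.Flat R F → Function.Injective f → Function.Exact f g → Function.Surjective g →
      IsSyzygy R n M → Function.Injective (f.lTensor N)

theorem TorVanishes.of_flat (R : Type u) [CommRing R] (N : Type u) [AddCommGroup N] [Module R N]
    [Module.Flat R N] : TorVanishes R 0 N :=
  fun _ _ _ _ _ _ _ _ _ f _ _ hf _ _ _ =>
    Module.Flat.lTensor_preserves_injective_linearMap f hf

theorem TorVanishes.succ {R : Type u} [CommRing R] {n : ℕ} {N : Type u} [AddCommGroup N]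
    [Module R N] (h : TorVanishes R n N) : TorVanishes R (n + 1) N :=
  fun K F M _ _ _ _ _ _ f g hF hf hfg hg hM => h K F M f g hF hf hfg hg hM.of_succ

theorem TorVanishes.mono {R : Type u} [CommRing R] {m n : ℕ} (hmn : m ≤ n) {N : Type u}
    [AddCommGroup N] [Module R N] (h : TorVanishes R m N) : TorVanishes R n N := by
  induction n, hmn using Nat.le_induction with
  | base => exact h
  | succ n _ ih => exact ih.succ

open Function TensorProduct in
theorem TorVanishes.of_exact {R : Type u} [CommRing R] {n : ℕ} {N₁ N₂ N₃ : Type u}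
    [AddCommGroup N₁] [Module R N₁] [AddCommGroup N₂] [Module R N₂] [AddCommGroup N₃]
    [Module R N₃] {i : N₁ →ₗ[R] N₂} {q : N₂ →ₗ[R] N₃} (hi : Injective i) (hiq : Exact i q)
    (hq : Surjective q) (h₁ : TorVanishes R n N₁) (h₂ : TorVanishes R (n + 1) N₂) :
    TorVanishes R (n + 1) N₃ := by
  intro K F M _ _ _ _ _ _ f g hF hf hfg hg hM
  have hf₂ : Injective (f.lTensor N₂) := h₂ K F M f g hF hf hfg hg hM
  have hiM : Injective (i.rTensor M) := by
    obtain ⟨F', _, _, M', _, _, f', g', hF', hf', hfg', hg', hM'⟩ := hM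
    have hf'₁ := h₁ M F' M' f' g' hF' hf' hfg' hg' hM'
    have := (Module.Flat.rTensor_preserves_injective_linearMap (M := F') i hi).comp hf'₁
    rw [← LinearMap.coe_comp, LinearMap.rTensor_comp_lTensor, ← LinearMap.lTensor_comp_rTensor,
      LinearMap.coe_comp] at this
    exact this.of_comp
  rw [injective_iff_map_eq_zero]
  intro u hu
  obtain ⟨u, rfl⟩ := LinearMap.rTensor_surjective K hq u
  have huq : q.rTensor F (f.lTensor N₂ u) = 0 := by
    rw [← LinearMap.comp_apply, LinearMap.rTensor_comp_lTensor, ← LinearMap.lTensor_comp_rTensor,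
      LinearMap.comp_apply, hu]
  obtain ⟨v, hv⟩ := (rTensor_exact F hiq hq _).mp huq
  have hvM : g.lTensor N₁ v = 0 := by
    apply (injective_iff_map_eq_zero _).mp hiM
    rw [← LinearMap.comp_apply, LinearMap.rTensor_comp_lTensor, ← LinearMap.lTensor_comp_rTensor,
      LinearMap.comp_apply, hv]
    exact (lTensor_exact N₂ hfg hg).apply_apply_eq_zero u
  obtain ⟨w, rfl⟩ := (lTensor_exact N₁ hfg hg v).mp hvM
  have hw : i.rTensor K w = u := by
    apply hf₂
    rw [← hv, ← LinearMap.comp_apply, LinearMap.lTensor_comp_rTensor,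
      ← LinearMap.rTensor_comp_lTensor, LinearMap.comp_apply]
  rw [← hw]
  exact (rTensor_exact K hiq hq).apply_apply_eq_zero w

open IsLocalRing in
theorem IsLocalRing.exists_mem_maximalIdeal_isSMulRegular {A N : Type*} [CommRing A]
    [IsNoetherianRing A] [IsLocalRing A] [AddCommGroup N] [Module A N] [Module.Finite A N]
    (hm : maximalIdeal A ∉ associatedPrimes A N) :
    ∃ x ∈ maximalIdeal A, IsSMulRegular N x := by
  by_contra! h
  have hsub : (maximalIdeal A : Set A) ⊆ ⋃ p ∈ associatedPrimes A N, (p : Set A) := by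
    rw [biUnion_associatedPrimes_eq_compl_regular A N]
    exact h
  obtain ⟨p, hp, hle⟩ := (Ideal.subset_union_prime_finite (associatedPrimes.finite A N) ⊥ ⊥
    fun p hp _ _ => IsAssociatedPrime.isPrime hp).mp hsub
  have hpm : p = maximalIdeal A :=
    le_antisymm (le_maximalIdeal (IsAssociatedPrime.isPrime hp).ne_top) hle
  exact hm (hpm ▸ hp)

open Pointwise in
theorem TorVanishes.quotSMulTop {R : Type u} [CommRing R] {A : Type u} [CommRing A] [Algebra R A]
    {n : ℕ} {N : Type u} [AddCommGroup N] [Module A N] [Module R N] [IsScalarTower R A N] {x : A}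
    (hx : IsSMulRegular N x) (h : TorVanishes R n N) : TorVanishes R (n + 1) (QuotSMulTop x N) := by
  let i : N →ₗ[R] N := (LinearMap.lsmul A N x).restrictScalars R
  let qA : N →ₗ[A] QuotSMulTop x N := Submodule.mkQ (x • (⊤ : Submodule A N))
  let q : N →ₗ[R] QuotSMulTop x N := qA.restrictScalars R
  have hq : Function.Surjective q := Submodule.mkQ_surjective (x • (⊤ : Submodule A N))
  have hiq : Function.Exact i q := by
    intro y
    change qA y = 0 ↔ ∃ z, x • z = y
    rw [Submodule.mkQ_apply, Submodule.Quotient.mk_eq_zero,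
      Submodule.mem_smul_pointwise_iff_exists]
    simp
  exact TorVanishes.of_exact (i := i) hx hiq hq h h.succ

open IsLocalRing in
/-- Let `A` be a Noetherian local `R`-algebra and `N` a nonzero finite `A`-module of dimension at
most `s` with `Torₙ₊₁(N, -) = 0` over `R`. Dividing `N` by a maximal regular sequence gives a
module of depth zero whose `Tor` vanishes in degrees greater than `n + s`. -/
theorem TorVanishes.exists_maximalIdeal_mem_associatedPrimes {R : Type u} [CommRing R]
    {A : Type u} [CommRing A] [Algebra R A] [IsNoetherianRing A] [IsLocalRing A]
    (s : ℕ) {n : ℕ} {N : Type u} [AddCommGroup N] [Module A N] [Module R N] [IsScalarTower R A N]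
    [Module.Finite A N] [Nontrivial N] (hN : Module.supportDim A N ≤ s)
    (h : TorVanishes R n N) :
    ∃ (N' : Type u) (_ : AddCommGroup N') (_ : Module A N') (_ : Module R N'),
      IsScalarTower R A N' ∧ TorVanishes R (n + s) N' ∧
        maximalIdeal A ∈ associatedPrimes A N' := by
  induction s generalizing n N with
  | zero =>
    by_cases hm : maximalIdeal A ∈ associatedPrimes A N
    · exact ⟨N, _, _, _, inferInstance, h, hm⟩
    obtain ⟨x, hx, hreg⟩ := exists_mem_maximalIdeal_isSMulRegular hm
    have := nontrivial_quotSMulTop_of_mem_maximalIdeal N hx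
    have hne := Module.supportDim_ne_bot_of_nontrivial A (QuotSMulTop x N)
    rw [← Module.supportDim_quotSMulTop_succ_eq_supportDim hreg hx] at hN
    lift Module.supportDim A (QuotSMulTop x N) to ℕ∞ using hne with e
    have : e + 1 ≤ 0 := by exact_mod_cast hN
    simp at this
  | succ s ih =>
    by_cases hm : maximalIdeal A ∈ associatedPrimes A N
    · exact ⟨N, _, _, _, inferInstance, h.mono (by omega), hm⟩
    obtain ⟨x, hx, hreg⟩ := exists_mem_maximalIdeal_isSMulRegular hm
    have := nontrivial_quotSMulTop_of_mem_maximalIdeal N hx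
    have hdim : Module.supportDim A (QuotSMulTop x N) ≤ s := by
      have hne := Module.supportDim_ne_bot_of_nontrivial A (QuotSMulTop x N)
      rw [← Module.supportDim_quotSMulTop_succ_eq_supportDim hreg hx] at hN
      lift Module.supportDim A (QuotSMulTop x N) to ℕ∞ using hne with e
      have he : e + 1 ≤ s + 1 := by exact_mod_cast hN
      exact_mod_cast (ENat.add_le_add_iff_right ENat.one_ne_top).mp he
    have := ih hdim (h.quotSMulTop hreg)
    rwa [add_right_comm, add_assoc] at this

/-- For a prime `p`, the module `R ⧸ p` embeds into a module whose `Tor` vanishes in degrees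
greater than the height of `p`. -/
theorem Ideal.exists_torVanishes_quotient_injective {R : Type u} [CommRing R] [IsNoetherianRing R]
    (p : Ideal R) [p.IsPrime] {d : ℕ} (hd : p.height ≤ d) :
    ∃ (N : Type u) (_ : AddCommGroup N) (_ : Module R N) (i : R ⧸ p →ₗ[R] N),
      Function.Injective i ∧ TorVanishes R d N := by
  let A := Localization.AtPrime p
  have : Module.Flat R A := IsLocalization.flat A p.primeCompl
  have : IsNoetherianRing A := IsLocalization.isNoetherianRing p.primeCompl A inferInstance
  have hA : Module.supportDim A A ≤ d := by
    rw [Module.supportDim_self_eq_ringKrullDim, IsLocalization.AtPrime.ringKrullDim_eq_height p A]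
    exact WithBot.coe_le_coe.mpr hd
  obtain ⟨N, _, _, _, _, hN, hm⟩ :=
    (TorVanishes.of_flat R A).exists_maximalIdeal_mem_associatedPrimes d hA
  rw [zero_add] at hN
  obtain ⟨-, y, hy⟩ := isAssociatedPrime_iff.mp (AssociatedPrimes.mem_iff.mp hm)
  have hpy : p = LinearMap.ker (LinearMap.toSpanSingleton R N y) := by
    ext r
    rw [LinearMap.mem_ker, LinearMap.toSpanSingleton_apply, ← algebraMap_smul A r y,
      ← Submodule.mem_bot A, ← Submodule.mem_colon_singleton, ← hy,
      IsLocalization.AtPrime.to_map_mem_maximal_iff A p]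
  exact ⟨N, _, _, p.liftQ _ hpy.le,
    LinearMap.ker_eq_bot.mp (Submodule.ker_liftQ_eq_bot _ _ _ hpy.ge), hN⟩

/-- Over a Noetherian ring of dimension at most `d`, a `d`-th syzygy that has flat dimension at
most one is flat. -/
theorem IsSyzygy.flat {R : Type u} [CommRing R] [IsNoetherianRing R] {d : ℕ}
    (hd : ringKrullDim R ≤ d) {K F M : Type u} [AddCommGroup K] [Module R K] [AddCommGroup F]
    [Module R F] [AddCommGroup M] [Module R M] [Module.Flat R K] [Module.Flat R F]
    {f : K →ₗ[R] F} {g : F →ₗ[R] M} (hf : Function.Injective f) (hfg : Function.Exact f g)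
    (hg : Function.Surjective g) (hM : IsSyzygy R d M) : Module.Flat R M := by
  suffices ∀ (N : Type u) [AddCommGroup N] [Module R N] [Module.Finite R N],
      Function.Injective (f.lTensor N) from
    Module.flat_of_forall_lTensor_injective hg hfg fun I => this (R ⧸ I)
  intro N _ _ hN
  induction hN using
    IsNoetherianRing.induction_on_isQuotientEquivQuotientPrime R with
  | subsingleton N => exact Function.injective_of_subsingleton _
  | quotient N p e =>
    have hp : p.1.height ≤ d :=
      WithBot.coe_le_coe.mp (Ideal.height_le_ringKrullDim_of_isPrime.trans hd)
    obtain ⟨N', _, _, i, hi, hN'⟩ := p.1.exists_torVanishes_quotient_injective hp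
    exact LinearMap.lTensor_injective_of_injective
      (i := i ∘ₗ e.toLinearMap) (hi.comp e.injective)
      (hN' K F M f g inferInstance hf hfg hg hM)
  | exact N₁ N₂ N₃ i q hi hq hiq h₁ h₃ =>
    exact LinearMap.lTensor_injective_of_exact hi hq hiq h₁ h₃

theorem HasFlatDimLE.of_succ {R : Type} [CommRing R] [IsNoetherianRing R] {d : ℕ}
    (hd : ringKrullDim R ≤ d) (n : ℕ) {j : ℕ} (hnj : d ≤ n + j) {M : Type} [AddCommGroup M]
    [Module R M] (hM : IsSyzygy R j M) (h : HasFlatDimLE R (n + 1) M) : HasFlatDimLE R n M := by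
  induction n generalizing j M with
  | zero =>
    obtain ⟨F, _, _, f, hF, hf, hK⟩ := h
    have : Module.Flat R (LinearMap.ker f) := hK
    have hj : ringKrullDim R ≤ j := hd.trans (by exact_mod_cast (zero_add j ▸ hnj))
    exact IsSyzygy.flat hj (Submodule.subtype_injective _) (LinearMap.exact_subtype_ker_map f) hf hM
  | succ n ih =>
    obtain ⟨F, _, _, f, hF, hf, hK⟩ := h
    refine ⟨F, _, _, f, hF, hf, ih (j := j + 1) (by omega) ?_ hK⟩
    exact ⟨F, _, _, M, _, _, (LinearMap.ker f).subtype, f, hF, Submodule.subtype_injective _,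
      LinearMap.exact_subtype_ker_map f, hf, hM⟩

theorem HasFlatDimLE.succ {R : Type} [CommRing R] {n : ℕ} {M : Type} [AddCommGroup M]
    [Module R M] (h : HasFlatDimLE R n M) : HasFlatDimLE R (n + 1) M := by
  induction n generalizing M with
  | zero =>
    have : Module.Flat R M := h
    refine ⟨M, _, _, LinearMap.id, h, Function.surjective_id, ?_⟩
    rw [LinearMap.ker_id]
    exact inferInstanceAs (Module.Flat R (⊥ : Submodule R M))
  | succ n ih =>
    obtain ⟨F, _, _, f, hF, hf, hK⟩ := h
    exact ⟨F, _, _, f, hF, hf, ih hK⟩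

theorem HasFlatDimLE.mono {R : Type} [CommRing R] {m n : ℕ} (hmn : m ≤ n) {M : Type}
    [AddCommGroup M] [Module R M] (h : HasFlatDimLE R m M) : HasFlatDimLE R n M := by
  induction n, hmn using Nat.le_induction with
  | base => exact h
  | succ n _ ih => exact ih.succ

/-- If `R` is a commutative Noetherian ring of Krull dimension at most `d`,
then every `R`-module of finite flat dimension has flat dimension at most `d`; i.e. the
finitistic flat dimension of `R` is at most its Krull dimension. -/
theorem steenrod_stmt_9 (R : Type) [CommRing R] [IsNoetherianRing R]
    (d : ℕ) (hdim : ringKrullDim R = (d : WithBot (WithTop ℕ)))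
    (M : Type) [AddCommGroup M] [Module R M]
    (hfin : ∃ n : ℕ, HasFlatDimLE R n M) :
    HasFlatDimLE R d M := by
  obtain ⟨n, hn⟩ := hfin
  induction n with
  | zero => exact hn.mono d.zero_le
  | succ n ih =>
    obtain hnd | hdn := Nat.lt_or_ge n d
    · exact hn.mono hnd
    · exact ih (hn.of_succ hdim.le n (j := 0) hdn trivial)
end
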